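/- arXiv:1603.05046 — 2 statements merged into one kernel-verified Lean document; each statement's English description precedes it below -/
import Mathlib

section
/- Let N ≥ 1, let A be a symmetric positive semidefinite N×N real matrix, and let s ≥ 2 be a real number. Then for all vectors ξ₁, ξ₂ ∈ ℝ^N the following Clarkson-type inequality holds: (⟨Aξ₁,ξ₁⟩^{s/2} + ⟨Aξ₂,ξ₂⟩^{s/2})/2 ≥ ⟨A((ξ₁+ξ₂)/2), (ξ₁+ξ₂)/2⟩^{s/2} + ⟨A((ξ₁−ξ₂)/2), (ξ₁−ξ₂)/2⟩^{s/2}. -/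
open Matrix

/-- The parallelogram law for the quadratic form of a real square matrix, at half sum and half
difference. -/
theorem Matrix.mulVec_half_add_dotProduct_add_mulVec_half_sub_dotProduct {n : Type*} [Fintype n]
    (A : Matrix n n ℝ) (v w : n → ℝ) :
    A.mulVec ((v + w) / 2) ⬝ᵥ ((v + w) / 2) + A.mulVec ((v - w) / 2) ⬝ᵥ ((v - w) / 2)
      = (A.mulVec v ⬝ᵥ v + A.mulVec w ⬝ᵥ w) / 2 := by
  have half (u : n → ℝ) : u / 2 = (2⁻¹ : ℝ) • u := by
    ext i
    simp [div_eq_inv_mul]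
  simp only [half, mulVec_smul, mulVec_add, mulVec_sub, smul_dotProduct, dotProduct_smul,
    add_dotProduct, sub_dotProduct, dotProduct_add, dotProduct_sub, smul_eq_mul]
  ring

/-- Clarkson-type inequality for a symmetric positive semidefinite matrix `A`
and real exponent `s ≥ 2`:
`(⟨Aξ₁,ξ₁⟩^(s/2) + ⟨Aξ₂,ξ₂⟩^(s/2))/2 ≥ ⟨A((ξ₁+ξ₂)/2),(ξ₁+ξ₂)/2⟩^(s/2) + ⟨A((ξ₁−ξ₂)/2),(ξ₁−ξ₂)/2⟩^(s/2)`. -/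
theorem clarkson_type_inequality (N : ℕ) (hN : 1 ≤ N)
    (A : Matrix (Fin N) (Fin N) ℝ)
    (hsymm : A.transpose = A)
    (hpsd : ∀ ξ : Fin N → ℝ, 0 ≤ A.mulVec ξ ⬝ᵥ ξ)
    (s : ℝ) (hs : 2 ≤ s) (ξ₁ ξ₂ : Fin N → ℝ) :
    (A.mulVec ((ξ₁ + ξ₂) / 2) ⬝ᵥ ((ξ₁ + ξ₂) / 2)) ^ (s / 2)
      + (A.mulVec ((ξ₁ - ξ₂) / 2) ⬝ᵥ ((ξ₁ - ξ₂) / 2)) ^ (s / 2)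
      ≤ ((A.mulVec ξ₁ ⬝ᵥ ξ₁) ^ (s / 2) + (A.mulVec ξ₂ ⬝ᵥ ξ₂) ^ (s / 2)) / 2 := by
  have hp : 1 ≤ s / 2 := by linarith
  refine (Real.add_rpow_le_rpow_add (hpsd _) (hpsd _) hp).trans ?_
  rw [A.mulVec_half_add_dotProduct_add_mulVec_half_sub_dotProduct]
  have h := (convexOn_rpow hp).2 (hpsd ξ₁) (hpsd ξ₂) (by norm_num : (0 : ℝ) ≤ 1 / 2)
    (by norm_num : (0 : ℝ) ≤ 1 / 2) (by norm_num)
  simp only [smul_eq_mul, one_div, ← div_eq_inv_mul, ← add_div] at h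
  exact h
end

section
/- Let N ≥ 1, let A be a symmetric N×N real matrix satisfying the ellipticity condition ⟨Aξ,ξ⟩ ≥ |ξ|² for all ξ ∈ ℝ^N, and let s ≥ 2 be a real number. Then for all vectors ξ₁, ξ₂ ∈ ℝ^N one has the uniform convexity estimate (1/2)⟨Aξ₁,ξ₁⟩^{s/2} + (1/2)⟨Aξ₂,ξ₂⟩^{s/2} − ⟨A((ξ₁+ξ₂)/2), (ξ₁+ξ₂)/2⟩^{s/2} ≥ |(ξ₁−ξ₂)/2|^s. -/
open Matrix

/-- Parallelogram identity for the quadratic form of a matrix. -/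
lemma mulVec_dotProduct_parallelogram {n : Type*} [Fintype n] (A : Matrix n n ℝ) (x y : n → ℝ) :
    A.mulVec ((x + y) / 2) ⬝ᵥ ((x + y) / 2) + A.mulVec ((x - y) / 2) ⬝ᵥ ((x - y) / 2)
      = (1 / 2) * (A.mulVec x ⬝ᵥ x) + (1 / 2) * (A.mulVec y ⬝ᵥ y) := by
  have half (v : n → ℝ) : v / 2 = (1 / 2 : ℝ) • v := by
    ext i
    simp [div_eq_inv_mul]
  simp only [half, mulVec_smul, mulVec_add, mulVec_sub, smul_dotProduct, dotProduct_smul,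
    add_dotProduct, dotProduct_add, sub_dotProduct, dotProduct_sub, smul_eq_mul]
  ring

/-- Uniform convexity estimate: for a symmetric matrix `A` satisfying the
ellipticity condition `⟨Aξ,ξ⟩ ≥ |ξ|²` and a real exponent `s ≥ 2`,
`(1/2)⟨Aξ₁,ξ₁⟩^(s/2) + (1/2)⟨Aξ₂,ξ₂⟩^(s/2) − ⟨A((ξ₁+ξ₂)/2),(ξ₁+ξ₂)/2⟩^(s/2)
  ≥ |(ξ₁−ξ₂)/2|^s`. -/
theorem uniform_convexity_estimate (N : ℕ) (hN : 1 ≤ N)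
    (A : Matrix (Fin N) (Fin N) ℝ)
    (hsymm : A.transpose = A)
    (hell : ∀ ξ : Fin N → ℝ, ξ ⬝ᵥ ξ ≤ A.mulVec ξ ⬝ᵥ ξ)
    (s : ℝ) (hs : 2 ≤ s) (ξ₁ ξ₂ : Fin N → ℝ) :
    Real.sqrt (((ξ₁ - ξ₂) / 2) ⬝ᵥ ((ξ₁ - ξ₂) / 2)) ^ s
      ≤ (1 / 2) * (A.mulVec ξ₁ ⬝ᵥ ξ₁) ^ (s / 2)
        + (1 / 2) * (A.mulVec ξ₂ ⬝ᵥ ξ₂) ^ (s / 2)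
        - (A.mulVec ((ξ₁ + ξ₂) / 2) ⬝ᵥ ((ξ₁ + ξ₂) / 2)) ^ (s / 2) := by
  set m := (ξ₁ + ξ₂) / 2
  set d := (ξ₁ - ξ₂) / 2
  have dot_nonneg (ξ : Fin N → ℝ) : 0 ≤ ξ ⬝ᵥ ξ :=
    Finset.sum_nonneg fun i _ => mul_self_nonneg (ξ i)
  have form_nonneg (ξ : Fin N → ℝ) : 0 ≤ A.mulVec ξ ⬝ᵥ ξ := (dot_nonneg ξ).trans (hell ξ)
  have hp : 1 ≤ s / 2 := by linarith
  have hsqrt : Real.sqrt (d ⬝ᵥ d) ^ s = (d ⬝ᵥ d) ^ (s / 2) := by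
    rw [Real.sqrt_eq_rpow, ← Real.rpow_mul (dot_nonneg d), one_div_mul_eq_div]
  have hmono : (d ⬝ᵥ d) ^ (s / 2) ≤ (A.mulVec d ⬝ᵥ d) ^ (s / 2) :=
    Real.rpow_le_rpow (dot_nonneg d) (hell d) (by linarith)
  have hsuper := Real.add_rpow_le_rpow_add (form_nonneg m) (form_nonneg d) hp
  have hconv := (convexOn_rpow hp).2 (Set.mem_Ici.2 (form_nonneg ξ₁))
    (Set.mem_Ici.2 (form_nonneg ξ₂)) (by norm_num : (0 : ℝ) ≤ 1 / 2)
    (by norm_num : (0 : ℝ) ≤ 1 / 2) (by norm_num)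
  simp only [smul_eq_mul] at hconv
  rw [mulVec_dotProduct_parallelogram A ξ₁ ξ₂] at hsuper
  rw [hsqrt]
  linarith
end
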